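/- arXiv:1708.09135 — 6 statements merged into one kernel-verified Lean document; each statement's English description precedes it below -/
import Mathlib

section
/- Let 1 ≤ k ≤ ℓ, let t = (t_{ℓ−1}, …, t_1) be the label code of a switch at layer k, and let u = (u_ℓ, …, u_1) be a host label code. Then there exists a downward path from t to host u — a sequence of switches, one at each layer k, k−1, …, 1, in which consecutive switches are connected and the layer-1 switch is attached to u — if and only if t_j = u_{j+1} for all j with k ≤ j ≤ ℓ−1. In that case the downward path is unique: the switch visited at layer j (1 ≤ j ≤ k) has label code (t_1, …, t_{j−1}, u_{j+1}, …, u_ℓ), and the sequence of down-ports traversed is (u_k, u_{k−1}, …, u_1). -/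
/-- A host label code in the fat-tree `F(ℓ, d)`: the top coordinate `h_ℓ`
(0-based index `ℓ-1`) lies in `Z_{2d}` and all other coordinates lie in `Z_d`.
The 0-based index `i` corresponds to the 1-based coordinate `i+1`. -/
def IsHostCode (d ℓ : ℕ) (h : Fin ℓ → ℕ) : Prop :=
  ∀ i : Fin ℓ, if (i : ℕ) = ℓ - 1 then h i < 2 * d else h i < d

/-- The label code of a switch at layer `k` in `F(ℓ, d)`: a vector of `ℓ-1`
coordinates; for an intermediate switch (`k ≠ ℓ`) the top coordinate `s_{ℓ-1}`
lies in `Z_{2d}` and the rest in `Z_d`; a core switch code lies in `Z_d^{ℓ-1}`. -/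
def IsSwitchCode (d ℓ k : ℕ) (s : Fin (ℓ - 1) → ℕ) : Prop :=
  ∀ i : Fin (ℓ - 1), if k ≠ ℓ ∧ (i : ℕ) = ℓ - 2 then s i < 2 * d else s i < d

/-- A layer-`(m-1)` switch `x` and a layer-`m` switch `y` (`2 ≤ m ≤ ℓ`) are connected
iff they agree in all coordinates except the `(m-1)`-th (0-based index `m-2`).
The connection uses up-port `y_{m-1}` of `x` and down-port `x_{m-1}` of `y`. -/
def ConnectedAt (ℓ m : ℕ) (x y : Fin (ℓ - 1) → ℕ) : Prop :=
  ∀ i : Fin (ℓ - 1), (i : ℕ) ≠ m - 2 → x i = y i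

/-- The host `h` is attached to the layer-1 switch `(h_ℓ, …, h_2)`. -/
def AttachedTo (ℓ : ℕ) (s : Fin (ℓ - 1) → ℕ) (h : Fin ℓ → ℕ) : Prop :=
  ∀ i : Fin (ℓ - 1), s i = h ⟨(i : ℕ) + 1, by have := i.isLt; omega⟩

/-- A downward path from the layer-`k` switch `t` to the host `u`: a sequence of
switches, one at each layer `k, k-1, …, 1`, in which consecutive switches are
connected and the layer-1 switch is attached to `u`. -/
def IsDownPath (ℓ k : ℕ) (t : Fin (ℓ - 1) → ℕ) (u : Fin ℓ → ℕ)
    (w : ℕ → Fin (ℓ - 1) → ℕ) : Prop :=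
  w k = t ∧ (∀ j, 2 ≤ j → j ≤ k → ConnectedAt ℓ j (w (j - 1)) (w j)) ∧
    AttachedTo ℓ (w 1) u

/-- Going down from layer `k` to layer `j` leaves the first `j - 1` coordinates unchanged. -/
theorem IsDownPath.apply_eq_start {ℓ k : ℕ} {t : Fin (ℓ - 1) → ℕ} {u : Fin ℓ → ℕ}
    {w : ℕ → Fin (ℓ - 1) → ℕ} (hw : IsDownPath ℓ k t u w) {j : ℕ} (hj : 1 ≤ j) (hjk : j ≤ k)
    {i : Fin (ℓ - 1)} (hi : (i : ℕ) < j - 1) : w j i = t i := by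
  induction hjk using Nat.decreasingInduction with
  | self => rw [hw.1]
  | of_succ j hjk ih =>
    rw [← ih (by omega) (by omega)]
    exact hw.2.1 (j + 1) (by omega) hjk i (by omega)

/-- Going down from layer `j` to layer `1` leaves the coordinates from the `j`-th on unchanged,
so they are dictated by the host. -/
theorem IsDownPath.apply_eq_host {ℓ k : ℕ} {t : Fin (ℓ - 1) → ℕ} {u : Fin ℓ → ℕ}
    {w : ℕ → Fin (ℓ - 1) → ℕ} (hw : IsDownPath ℓ k t u w) {j : ℕ} (hj : 1 ≤ j) (hjk : j ≤ k)
    {i : Fin (ℓ - 1)} (hi : j - 1 ≤ (i : ℕ)) :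
    w j i = u ⟨(i : ℕ) + 1, by have := i.isLt; omega⟩ := by
  induction j, hj using Nat.le_induction with
  | base => exact hw.2.2 i
  | succ j hj ih =>
    rw [← ih (by omega) (by omega)]
    exact (hw.2.1 (j + 1) (by omega) hjk i (by omega)).symm

/-- The switches `(t_1, …, t_{j-1}, u_{j+1}, …, u_ℓ)` form a downward path as soon as `t` and `u`
agree in the coordinates that no step below layer `k` can change. -/
theorem isDownPath_of_agree {ℓ k : ℕ} {t : Fin (ℓ - 1) → ℕ} {u : Fin ℓ → ℕ}
    (h : ∀ i : Fin (ℓ - 1), k - 1 ≤ (i : ℕ) →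
      t i = u ⟨(i : ℕ) + 1, by have := i.isLt; omega⟩) :
    IsDownPath ℓ k t u (fun j i => if (i : ℕ) < j - 1 then t i
      else u ⟨(i : ℕ) + 1, by have := i.isLt; omega⟩) := by
  refine ⟨?_, ?_, ?_⟩
  · funext i
    dsimp only
    split_ifs with hi
    · rfl
    · exact (h i (by omega)).symm
  · intro j hj _ i hi
    have : (i : ℕ) < j - 1 - 1 ↔ (i : ℕ) < j - 1 := by omega
    simp only [this]
  · intro i
    simp

/-- A downward path from a layer-`k` switch `t` to a host `u` exists iff
`t_j = u_{j+1}` for all `k ≤ j ≤ ℓ-1`; in that case the path is unique, the switch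
visited at layer `j` has label code `(t_1, …, t_{j-1}, u_{j+1}, …, u_ℓ)`, and the
sequence of down-ports traversed is `(u_k, …, u_1)` (the down-port used at layer
`j ≥ 2` — coordinate `j-1` of the layer-`(j-1)` switch — equals `u_j`; by the
attachment the down-port at layer 1 is `u_1`). -/
theorem downward_path_exists_unique (d ℓ k : ℕ) (hd : 1 ≤ d) (hℓ : 2 ≤ ℓ)
    (hk1 : 1 ≤ k) (hk2 : k ≤ ℓ)
    (t : Fin (ℓ - 1) → ℕ) (ht : IsSwitchCode d ℓ k t)
    (u : Fin ℓ → ℕ) (hu : IsHostCode d ℓ u) :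
    ((∃ w, IsDownPath ℓ k t u w) ↔
      (∀ j (_ : k ≤ j) (_ : j ≤ ℓ - 1), t ⟨j - 1, by omega⟩ = u ⟨j, by omega⟩)) ∧
    (∀ w, IsDownPath ℓ k t u w → ∀ j (_ : 1 ≤ j) (_ : j ≤ k), ∀ i : Fin (ℓ - 1),
        w j i = if (i : ℕ) < j - 1 then t i
                else u ⟨(i : ℕ) + 1, by have := i.isLt; omega⟩) ∧
    (∀ w, IsDownPath ℓ k t u w → ∀ j (_ : 2 ≤ j) (_ : j ≤ k),
        w (j - 1) ⟨j - 2, by omega⟩ = u ⟨j - 1, by omega⟩) := by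
  refine ⟨⟨?_, ?_⟩, ?_, ?_⟩
  · rintro ⟨w, hw⟩ j hkj hj
    have h := hw.apply_eq_host hk1 le_rfl (i := ⟨j - 1, by omega⟩) (Nat.sub_le_sub_right hkj 1)
    rw [hw.1] at h
    simpa only [Nat.sub_add_cancel (hk1.trans hkj)] using h
  · intro h
    refine ⟨_, isDownPath_of_agree fun i hi => ?_⟩
    exact h (i + 1) (by omega) (by omega)
  · intro w hw j hj hjk i
    split_ifs with hi
    · exact hw.apply_eq_start hj hjk hi
    · exact hw.apply_eq_host hj hjk (by omega)
  · intro w hw j hj hjk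
    have h := hw.apply_eq_host (j := j - 1) (i := ⟨j - 2, by omega⟩) (by omega) (by omega)
      (Nat.sub_sub j 1 1).le
    simpa only [show j - 2 + 1 = j - 1 by omega] using h
end

section
/- Let N ≥ 2, let T be a nonnegative integer, let λ ∈ (0,1), and let Q : Fin N → ℕ. For an ordered pair (i,j) with i ≠ j, let Q'_{ij} = Q_j if Q_j + T < Q_i and Q'_{ij} = Q_i otherwise. Then the Foster–Lyapunov drift of V(Q) = Σ_i Q_i² under TTC routing with total arrival rate Nλ and unit service rates satisfies (λ/(N−1)) · Σ_{(i,j): i ≠ j} (2 Q'_{ij} + 1) + Σ_{i : Q_i > 0} (1 − 2 Q_i) ≤ 2(λ−1) Σ_{i=1}^{N} Q_i + (λ+1) N. -/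
/-- Foster–Lyapunov drift bound for TTC routing with total arrival rate `Nλ` and
unit service rates, for `V(Q) = Σ_i Q_i²`: with `Q'_{ij} = Q_j` if `Q_j + T < Q_i`
and `Q'_{ij} = Q_i` otherwise,
`(λ/(N−1)) Σ_{(i,j): i≠j} (2 Q'_{ij} + 1) + Σ_{i : Q_i > 0} (1 − 2 Q_i)
  ≤ 2(λ−1) Σ_i Q_i + (λ+1) N`. -/
theorem ttc_lyapunov_drift (N : ℕ) (hN : 2 ≤ N) (T : ℕ)
    (lam : ℝ) (hlam0 : 0 < lam) (hlam1 : lam < 1) (Q : Fin N → ℕ) :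
    lam / ((N : ℝ) - 1) *
        (∑ i : Fin N, ∑ j : Fin N,
          if i ≠ j then
            2 * (if Q j + T < Q i then (Q j : ℝ) else (Q i : ℝ)) + 1
          else 0) +
      (∑ i : Fin N, if 0 < Q i then 1 - 2 * (Q i : ℝ) else 0) ≤
    2 * (lam - 1) * (∑ i : Fin N, (Q i : ℝ)) + (lam + 1) * N := by
  have hN' : (0 : ℝ) < (N : ℝ) - 1 := by
    have : (2 : ℝ) ≤ N := by exact_mod_cast hN
    linarith
  have arrivals : (∑ i : Fin N, ∑ j : Fin N,
      if i ≠ j then 2 * (if Q j + T < Q i then (Q j : ℝ) else (Q i : ℝ)) + 1 else 0) ≤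
      ((N : ℝ) - 1) * (2 * (∑ i : Fin N, (Q i : ℝ)) + N) := by
    calc
      _ ≤ ∑ i : Fin N, ∑ j : Fin N, if i ≠ j then 2 * (Q i : ℝ) + 1 else 0 := by
        refine Finset.sum_le_sum fun i _ => Finset.sum_le_sum fun j _ => ?_
        split_ifs with hij hlt
        · have : (Q j : ℝ) ≤ Q i := by exact_mod_cast (show Q j ≤ Q i by omega)
          linarith
        · exact le_rfl
        · exact le_rfl
      _ = ∑ i : Fin N, ((N : ℝ) - 1) * (2 * (Q i : ℝ) + 1) := by
        refine Finset.sum_congr rfl fun i _ => ?_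
        have hcard : (Finset.univ.filter fun j : Fin N => i ≠ j).card = N - 1 := by
          rw [Finset.filter_ne, Finset.card_erase_of_mem (Finset.mem_univ i), Finset.card_fin]
        rw [← Finset.sum_filter, Finset.sum_const, hcard, nsmul_eq_mul,
          Nat.cast_sub (by omega), Nat.cast_one]
      _ = _ := by
        rw [← Finset.mul_sum, Finset.sum_add_distrib, ← Finset.mul_sum]
        simp
  have departures : (∑ i : Fin N, if 0 < Q i then 1 - 2 * (Q i : ℝ) else 0) ≤
      N - 2 * ∑ i : Fin N, (Q i : ℝ) := by
    calc
      _ ≤ ∑ i : Fin N, (1 - 2 * (Q i : ℝ)) := by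
        refine Finset.sum_le_sum fun i _ => ?_
        split_ifs with h
        · exact le_rfl
        · simp [Nat.eq_zero_of_not_pos h]
      _ = _ := by simp [Finset.sum_sub_distrib, Finset.mul_sum]
  have scaled := mul_le_mul_of_nonneg_left arrivals (div_pos hlam0 hN').le
  rw [← mul_assoc, div_mul_cancel₀ _ hN'.ne'] at scaled
  linarith
end

section
/- Every fixed-point solution s of the TTC mean-field equations satisfies s_1 = λ; consequently the expected departure rate of a single queue at equilibrium equals the arrival rate λ. -/
/-- A fixed-point solution of the TTC mean-field equations with threshold `T` and
arrival rate `λ`: a nonincreasing sequence `s : ℤ → ℝ` with values in `[0,1]`,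
equal to `1` on nonpositive indices, tending to `0` at `+∞`, and satisfying
`s_i − s_{i+1} = λ p_{i−1}(s_{i−T−1} + s_{i+T})` for all `i ≥ 1`,
where `p_i = s_i − s_{i+1}`. -/
def IsTTCFixedPoint (T : ℕ) (lam : ℝ) (s : ℤ → ℝ) : Prop :=
  Antitone s ∧ (∀ i, 0 ≤ s i ∧ s i ≤ 1) ∧ (∀ j : ℤ, j ≤ 0 → s j = 1) ∧
    Filter.Tendsto s Filter.atTop (nhds 0) ∧
    ∀ i : ℤ, 1 ≤ i →
      s i - s (i + 1) = lam * (s (i - 1) - s i) * (s (i - T - 1) + s (i + T))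

/-- A conserved quantity: along a fixed point, `s (n + 1) - lam * ttcPotential T s n` does not
depend on `n ≥ 0`. -/
noncomputable def ttcPotential (T : ℕ) (s : ℤ → ℝ) (n : ℤ) : ℝ :=
  ∑ j ∈ Finset.range (T + 1), s (n + j) * s (n + j - T) -
    ∑ j ∈ Finset.range T, s (n + j - T) * s (n + j + 1)

theorem ttcPotential_sub_succ (T : ℕ) (s : ℤ → ℝ) (n : ℤ) :
    ttcPotential T s n - ttcPotential T s (n + 1) =
      (s n - s (n + 1)) * (s (n - T) + s (n + T + 1)) := by
  have key : ∀ (f : ℤ → ℝ) (m : ℕ),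
      ∑ j ∈ Finset.range m, f (n + j) - ∑ j ∈ Finset.range m, f (n + 1 + j) =
        f n - f (n + m) := by
    intro f m
    rw [← Finset.sum_sub_distrib]
    simpa [add_assoc, add_comm (1 : ℤ)] using Finset.sum_range_sub' (fun j : ℕ => f (n + j)) m
  have e1 := key (fun k => s k * s (k - T)) (T + 1)
  have e2 := key (fun k => s (k - T) * s (k + 1)) T
  have a1 : n + ((T + 1 : ℕ) : ℤ) = n + T + 1 := by push_cast; ring
  have a2 : n + (T : ℤ) + 1 - T = n + 1 := by ring
  have a3 : n + (T : ℤ) - T = n := by ring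
  simp only [a1, a2, a3] at e1 e2
  unfold ttcPotential
  linear_combination e1 - e2

theorem ttcPotential_zero (T : ℕ) (s : ℤ → ℝ) (hs : ∀ j : ℤ, j ≤ 0 → s j = 1) :
    ttcPotential T s 0 = 1 := by
  have e1 : ∑ j ∈ Finset.range (T + 1), s (0 + j) * s (0 + j - T) =
      ∑ j ∈ Finset.range (T + 1), s j := by
    refine Finset.sum_congr rfl fun j hj => ?_
    rw [hs (0 + j - T) (by rw [Finset.mem_range] at hj; lia), zero_add, mul_one]
  have e2 : ∑ j ∈ Finset.range T, s (0 + j - T) * s (0 + j + 1) =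
      ∑ j ∈ Finset.range T, s ((j + 1 : ℕ) : ℤ) := by
    refine Finset.sum_congr rfl fun j hj => ?_
    rw [hs (0 + j - T) (by rw [Finset.mem_range] at hj; lia), zero_add, one_mul, Nat.cast_succ]
  rw [ttcPotential, e1, e2, Finset.sum_range_succ']
  simp [hs]

theorem tendsto_ttcPotential (T : ℕ) (s : ℤ → ℝ)
    (hs : Filter.Tendsto s Filter.atTop (nhds 0)) :
    Filter.Tendsto (ttcPotential T s) Filter.atTop (nhds 0) := by
  have shift : ∀ c : ℤ, Filter.Tendsto (fun n => s (n + c)) Filter.atTop (nhds 0) := fun c =>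
    hs.comp (Filter.tendsto_atTop_add_const_right _ c Filter.tendsto_id)
  have e1 := tendsto_finsetSum (Finset.range (T + 1)) fun j _ =>
    (shift j).mul (shift (j - T))
  have e2 := tendsto_finsetSum (Finset.range T) fun j _ =>
    (shift (j - T)).mul (shift (j + 1))
  have h := e1.sub e2
  simp only [mul_zero, Finset.sum_const_zero, sub_zero] at h
  refine h.congr fun n => ?_
  simp only [ttcPotential, add_sub_assoc, add_assoc]

/-- Every fixed-point solution of the TTC mean-field equations satisfies
`s_1 = λ`; consequently the expected departure rate of a single queue at
equilibrium equals the arrival rate `λ`. -/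
theorem ttc_fixed_point_s_one (T : ℕ) (hT : 1 ≤ T) (lam : ℝ)
    (h0 : 0 < lam) (h1 : lam < 1)
    (s : ℤ → ℝ) (hs : IsTTCFixedPoint T lam s) :
    s 1 = lam := by
  obtain ⟨-, -, hone, hlim, heq⟩ := hs
  have const : ∀ n : ℕ, s (n + 1) - lam * ttcPotential T s n = s 1 - lam := by
    intro n
    induction n with
    | zero => simp [ttcPotential_zero T s hone]
    | succ n ih =>
      have h := heq (n + 1) (by lia)
      have b1 : (n : ℤ) + 1 - 1 = n := by ring
      have b2 : (n : ℤ) + 1 - T - 1 = n - T := by ring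
      have b3 : (n : ℤ) + 1 + T = n + T + 1 := by ring
      rw [b1, b2, b3] at h
      push_cast
      linear_combination ih - h + lam * ttcPotential_sub_succ T s n
  have l1 : Filter.Tendsto (fun n : ℤ => s (n + 1)) Filter.atTop (nhds 0) :=
    hlim.comp (Filter.tendsto_atTop_add_const_right _ 1 Filter.tendsto_id)
  have l2 := (l1.sub ((tendsto_ttcPotential T s hlim).const_mul lam)).comp
    (tendsto_natCast_atTop_atTop (R := ℤ))
  have l3 : Filter.Tendsto (fun _ : ℕ => s 1 - lam) Filter.atTop (nhds (0 - lam * 0)) :=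
    l2.congr const
  have h := tendsto_nhds_unique l3 tendsto_const_nhds
  linarith
end

section
/- Let T ≥ 1 be an integer and let α > 1 be a real number with α^{T+1} ≤ α^T + 1. Set c = min_{0 ≤ i ≤ T+1} (i+1)/α^i. Then c > 0 and g_i ≥ c α^i for every integer i ≥ 0. -/
/-- On the initial segment `0 ≤ k ≤ T + 1`, where the delayed term is still `1`, the sequence is
`k + 1`. -/
theorem delayed_recurrence_initial {T : ℕ} {g : ℤ → ℝ} (hg1 : ∀ j : ℤ, j ≤ 0 → g j = 1)
    (hg2 : ∀ i : ℤ, 1 ≤ i → g i = g (i - 1) + g (i - 1 - T)) (k : ℕ) (hk : k ≤ T + 1) :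
    g k = k + 1 := by
  induction k with
  | zero => simp [hg1]
  | succ k ih =>
    rw [hg2 _ (by omega), hg1 (_ - 1 - _) (by omega), Nat.cast_succ, add_sub_cancel_right,
      ih (by omega), Nat.cast_succ]

/-- A geometric lower bound that holds on the initial segment propagates along the recurrence. -/
theorem delayed_recurrence_lower_bound {T : ℕ} {α c : ℝ} {g : ℤ → ℝ} (hα : 0 ≤ α) (hc : 0 ≤ c)
    (hineq : α ^ (T + 1) ≤ α ^ T + 1)
    (hg2 : ∀ i : ℤ, 1 ≤ i → g i = g (i - 1) + g (i - 1 - T))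
    (hinit : ∀ k : ℕ, k ≤ T → c * α ^ k ≤ g k) (n : ℕ) : c * α ^ n ≤ g n := by
  induction n using Nat.strong_induction_on with
  | _ n ih =>
    rcases le_or_gt n T with h | h
    · exact hinit n h
    obtain ⟨m, rfl⟩ := Nat.exists_eq_add_of_le' h
    have hrec : g (m + (T + 1) : ℕ) = g (m + T : ℕ) + g m := by
      rw [hg2 _ (by omega)]
      congr 2 <;> push_cast <;> ring
    calc c * α ^ (m + (T + 1)) = c * α ^ m * α ^ (T + 1) := by ring
      _ ≤ c * α ^ m * (α ^ T + 1) := by gcongr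
      _ = c * α ^ (m + T) + c * α ^ m := by ring
      _ ≤ g (m + T : ℕ) + g m := add_le_add (ih _ (by omega)) (ih _ (by omega))
      _ = g (m + (T + 1) : ℕ) := hrec.symm


/-- Let `T ≥ 1`, let `α > 1` satisfy `α^{T+1} ≤ α^T + 1`, and let `g : ℤ → ℝ` be
defined by `g_j = 1` for `j ≤ 0` and `g_i = g_{i−1} + g_{i−1−T}` for `i ≥ 1`.
With `c = min_{0 ≤ i ≤ T+1} (i+1)/α^i`, one has `c > 0` and `g_i ≥ c α^i` for
every integer `i ≥ 0`. -/
theorem g_grows_exponentially (T : ℕ) (hT : 1 ≤ T) (α : ℝ) (hα : 1 < α)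
    (hineq : α ^ (T + 1) ≤ α ^ T + 1)
    (g : ℤ → ℝ) (hg1 : ∀ j : ℤ, j ≤ 0 → g j = 1)
    (hg2 : ∀ i : ℤ, 1 ≤ i → g i = g (i - 1) + g (i - 1 - T)) :
    ∀ c : ℝ,
      c = (Finset.range (T + 2)).inf'
            (Finset.nonempty_range_iff.mpr (by omega))
            (fun i => ((i : ℝ) + 1) / α ^ i) →
      0 < c ∧ ∀ i : ℤ, 0 ≤ i → c * α ^ i ≤ g i := by
  intro c hc
  have hα0 : 0 < α := zero_lt_one.trans hα
  have hcpos : 0 < c := by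
    rw [hc, Finset.lt_inf'_iff]
    intro i _
    positivity
  refine ⟨hcpos, fun i hi => ?_⟩
  lift i to ℕ using hi
  rw [zpow_natCast]
  refine delayed_recurrence_lower_bound hα0.le hcpos.le hineq hg2 (fun k hk => ?_) i
  rw [delayed_recurrence_initial hg1 hg2 k (by omega), ← le_div_iff₀ (by positivity), hc]
  exact Finset.inf'_le (fun i : ℕ => ((i : ℝ) + 1) / α ^ i) (Finset.mem_range.mpr (by omega))
end

section
/- For every fixed-point solution s of the TTC mean-field equations there exist a constant c > 0 and a real α > 1 such that s_i ≤ λ^{c α^i − 1} for all i ≥ 1; in particular, the fixed-point solution decays doubly exponentially (there are constants c' > 0, 0 < μ < 1, α > 1, and n such that s_i ≤ c' μ^{α^i} for all i ≥ n). -/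
/-- Summing the recursion over all indices `≥ i` bounds the tail of a fixed point. -/
theorem IsTTCFixedPoint.le_two_mul_sq {T : ℕ} {lam : ℝ} {s : ℤ → ℝ}
    (hs : IsTTCFixedPoint T lam s) (h1 : lam ≤ 1) {i : ℤ} (hi : 1 ≤ i) :
    s i ≤ 2 * s (i - T - 1) ^ 2 := by
  obtain ⟨hanti, hbd, -, hlim, hrec⟩ := hs
  set K : ℝ := 2 * s (i - T - 1) with hK
  have hmono : Monotone fun n : ℕ => s (i + n) - K * s (i + n - 1) := by
    refine monotone_nat_of_le_succ fun n => ?_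
    have hr := hrec (i + n) (by omega)
    have hp : 0 ≤ s (i + n - 1) - s (i + n) := sub_nonneg.2 (hanti (by omega))
    have ha : s (i + n - T - 1) ≤ s (i - T - 1) := hanti (by omega)
    have hb : s (i + n + T) ≤ s (i - T - 1) := hanti (by omega)
    have hsum : lam * (s (i + n - T - 1) + s (i + n + T)) ≤ K := by
      have hnn := add_nonneg (hbd (i + n - T - 1)).1 (hbd (i + n + T)).1
      have := mul_le_of_le_one_left hnn h1
      linarith
    have hle := mul_le_mul_of_nonneg_left hsum hp
    have e1 : i + ((n + 1 : ℕ) : ℤ) = i + n + 1 := by push_cast; ring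
    have e2 : i + (n : ℤ) + 1 - 1 = i + n := by ring
    simp only [e1, e2]
    linarith
  have hshift : Filter.Tendsto (fun n : ℕ => s (i + n)) Filter.atTop (nhds 0) :=
    hlim.comp (Filter.tendsto_atTop_add_const_left _ i tendsto_natCast_atTop_atTop)
  have hshift' : Filter.Tendsto (fun n : ℕ => s (i + n - 1)) Filter.atTop (nhds 0) :=
    hlim.comp (Filter.tendsto_atTop_add_const_right _ (-1)
      (Filter.tendsto_atTop_add_const_left _ i tendsto_natCast_atTop_atTop))
  have hlim0 : Filter.Tendsto (fun n : ℕ => s (i + n) - K * s (i + n - 1))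
      Filter.atTop (nhds 0) := by
    simpa using hshift.sub (hshift'.const_mul K)
  have h := hmono.ge_of_tendsto hlim0 0
  simp only [Nat.cast_zero, add_zero] at h
  have hstep : s (i - 1) ≤ s (i - T - 1) := hanti (by omega)
  have hK0 : 0 ≤ K := mul_nonneg zero_le_two (hbd _).1
  have := mul_le_mul_of_nonneg_left hstep hK0
  rw [hK] at this h
  linarith

/-- A nonnegative antitone sequence with `u i ≤ u (i - d) ^ 2` which is at most `r < 1` at `N`
decays doubly exponentially from `N` on. -/
theorem le_rpow_of_le_sq {u : ℤ → ℝ} {d : ℕ} {N : ℤ} {r α c : ℝ} (hd : 0 < d)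
    (hanti : Antitone u) (hnn : ∀ i, 0 ≤ u i) (hsq : ∀ i, N < i → u i ≤ u (i - d) ^ 2)
    (hr0 : 0 < r) (hr1 : r ≤ 1) (hN : u N ≤ r) (hα : 1 ≤ α) (hαd : α ^ (d : ℝ) = 2)
    (hc0 : 0 ≤ c) (hc : c * α ^ ((N : ℝ) + d) ≤ 1) (n : ℕ) :
    u (N + n) ≤ r ^ (c * α ^ ((N : ℝ) + n)) := by
  induction n using Nat.strong_induction_on with
  | _ n ih =>
    rcases lt_or_ge n d with hlt | hge
    · have hexp : c * α ^ ((N : ℝ) + n) ≤ 1 := by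
        refine le_trans ?_ hc
        gcongr
      calc u (N + n) ≤ r := (hanti (by omega)).trans hN
        _ = r ^ (1 : ℝ) := (Real.rpow_one r).symm
        _ ≤ _ := Real.rpow_le_rpow_of_exponent_ge hr0 hr1 hexp
    · obtain ⟨m, rfl⟩ := Nat.exists_eq_add_of_le' hge
      have h := hsq (N + (m + d : ℕ)) (by omega)
      have e : N + ((m + d : ℕ) : ℤ) - d = N + m := by push_cast; ring
      rw [e] at h
      have hdouble : c * α ^ ((N : ℝ) + (m + d : ℕ)) = c * α ^ ((N : ℝ) + m) * (2 : ℕ) := by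
        have e' : (N : ℝ) + (m + d : ℕ) = N + m + d := by push_cast; ring
        rw [e', Real.rpow_add (by linarith), hαd]
        push_cast
        ring
      rw [hdouble, Real.rpow_mul_natCast hr0.le]
      exact h.trans (pow_le_pow_left₀ (hnn _) (ih m (by omega)) 2)

/-- For every fixed-point solution `s` of the TTC mean-field equations there exist
`c > 0` and `α > 1` such that `s_i ≤ λ^{c α^i − 1}` for all `i ≥ 1` (real
exponentiation); in particular `s` decays doubly exponentially: there are
`c' > 0`, `0 < μ < 1`, `α' > 1` and `n` such that `s_i ≤ c' μ^{α'^i}` for all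
`i ≥ n`. -/
theorem ttc_doubly_exponential_decay (T : ℕ) (hT : 1 ≤ T) (lam : ℝ)
    (h0 : 0 < lam) (h1 : lam < 1)
    (s : ℤ → ℝ) (hs : IsTTCFixedPoint T lam s) :
    ∃ c α : ℝ, 0 < c ∧ 1 < α ∧
      (∀ i : ℤ, 1 ≤ i → s i ≤ lam ^ (c * α ^ (i : ℝ) - 1)) ∧
      ∃ c' μ α' : ℝ, ∃ n : ℤ, 0 < c' ∧ 0 < μ ∧ μ < 1 ∧ 1 < α' ∧
        ∀ i : ℤ, n ≤ i → s i ≤ c' * μ ^ (α' ^ (i : ℝ)) := by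
  obtain ⟨hanti, hbd, -, hlim, -⟩ := id hs
  obtain ⟨N, hN0, hN⟩ : ∃ N : ℤ, 0 ≤ N ∧ 2 * s N ≤ lam :=
    ((Filter.eventually_ge_atTop 0).and
      ((hlim.eventually_le_const (half_pos h0)).mono fun i hi => by linarith)).exists
  set d : ℕ := T + 1 with hd
  have hd0 : (0 : ℝ) < d := by positivity
  set α : ℝ := 2 ^ (1 / (d : ℝ)) with hα
  have hα1 : 1 < α := Real.one_lt_rpow one_lt_two (by positivity)
  have hα0 : 0 < α := by linarith
  have hαd : α ^ (d : ℝ) = 2 := by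
    rw [hα, ← Real.rpow_mul zero_le_two, one_div_mul_cancel hd0.ne', Real.rpow_one]
  set c : ℝ := (α ^ ((N : ℝ) + d))⁻¹ with hc
  have hc0 : 0 < c := by positivity
  have hcN : c * α ^ ((N : ℝ) + d) = 1 := inv_mul_cancel₀ (by positivity)
  have hmain : ∀ i : ℤ, N ≤ i → s i ≤ lam ^ (c * α ^ (i : ℝ)) := by
    intro i hi
    obtain ⟨n, rfl⟩ := Int.le.dest hi
    have h := le_rpow_of_le_sq (u := fun i => 2 * s i) (d := d) (N := N) (Nat.succ_pos T)
      (fun a b hab => mul_le_mul_of_nonneg_left (hanti hab) zero_le_two)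
      (fun i => mul_nonneg zero_le_two (hbd i).1)
      (fun j hj => by
        have h := hs.le_two_mul_sq h1.le (i := j) (by omega)
        have e : j - (d : ℤ) = j - T - 1 := by rw [hd]; push_cast; ring
        simp only [e]
        linarith)
      h0 h1.le hN hα1.le hαd hc0.le hcN.le n
    have := (hbd (N + n)).1
    push_cast
    linarith
  refine ⟨c, α, hc0, hα1, fun i _ => ?_, 1, lam ^ c, α, N, one_pos, by positivity,
    Real.rpow_lt_one h0.le h1 hc0, hα1, fun i hi => ?_⟩
  · rcases le_or_gt N i with hi | hi
    · exact (hmain i hi).trans (Real.rpow_le_rpow_of_exponent_ge h0 h1.le (by linarith))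
    · refine (hbd i).2.trans (Real.one_le_rpow_of_pos_of_le_one_of_nonpos h0 h1.le ?_)
      have hiN : (i : ℝ) ≤ N + d := by
        have : (i : ℝ) < N := by exact_mod_cast hi
        linarith
      have := mul_le_mul_of_nonneg_left (Real.rpow_le_rpow_of_exponent_le hα1.le hiN) hc0.le
      linarith
  · rw [one_mul, ← Real.rpow_mul h0.le]
    exact hmain i hi
end

section
/- Let x, y : ℤ → ℝ be nonincreasing sequences with values in [0,1] such that x_j = y_j = 1 for all j ≤ 0 and Σ_{i≥0} |x_i − y_i| < ∞. Then the series Σ_{i≥1} |F_i(x) − F_i(y)| converges and Σ_{i≥1} |F_i(x) − F_i(y)| ≤ (6λ + 2) Σ_{i≥0} |x_i − y_i|; i.e., the drift field F of the TTC mean-field dynamics is Lipschitz with constant 6λ + 2 in the ℓ¹ norm. -/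
/-- The `i`-th component of the TTC mean-field drift (threshold `T`, arrival rate
`λ`): `F_i(x) = λ (x_{i−1} − x_i)(x_{i−1−T} + x_{i+T}) − (x_i − x_{i+1})`,
defined for `i ≥ 1`. -/
def ttcDrift (T : ℕ) (lam : ℝ) (x : ℤ → ℝ) (i : ℤ) : ℝ :=
  lam * (x (i - 1) - x i) * (x (i - 1 - T) + x (i + T)) - (x i - x (i + 1))

/-- Pointwise bound for the difference of two drift components. -/
lemma abs_ttcDrift_sub_le (T : ℕ) {lam : ℝ} (h0 : 0 ≤ lam) {x y : ℤ → ℝ}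
    (hx01 : ∀ i, 0 ≤ x i ∧ x i ≤ 1) (hy01 : ∀ i, 0 ≤ y i ∧ y i ≤ 1) (i : ℤ) :
    |ttcDrift T lam x i - ttcDrift T lam y i| ≤
      lam * (2 * (|x (i - 1) - y (i - 1)| + |x i - y i|) +
        (|x (i - 1 - T) - y (i - 1 - T)| + |x (i + T) - y (i + T)|)) +
      (|x i - y i| + |x (i + 1) - y (i + 1)|) := by
  have hsplit : ttcDrift T lam x i - ttcDrift T lam y i =
      lam * (((x (i - 1) - y (i - 1)) - (x i - y i)) * (x (i - 1 - T) + x (i + T)) +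
        (y (i - 1) - y i) * ((x (i - 1 - T) - y (i - 1 - T)) + (x (i + T) - y (i + T)))) -
      ((x i - y i) - (x (i + 1) - y (i + 1))) := by
    simp only [ttcDrift]; ring
  have hsum : |x (i - 1 - T) + x (i + T)| ≤ 2 := by
    rw [abs_le]
    constructor <;> linarith [hx01 (i - 1 - T), hx01 (i + T)]
  have hdiff : |y (i - 1) - y i| ≤ 1 := by
    rw [abs_le]
    constructor <;> linarith [hy01 (i - 1), hy01 i]
  have hfst : |((x (i - 1) - y (i - 1)) - (x i - y i)) * (x (i - 1 - T) + x (i + T))| ≤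
      2 * (|x (i - 1) - y (i - 1)| + |x i - y i|) := by
    rw [abs_mul, mul_comm]
    exact mul_le_mul hsum (abs_sub _ _) (abs_nonneg _) zero_le_two
  have hsnd : |(y (i - 1) - y i) *
      ((x (i - 1 - T) - y (i - 1 - T)) + (x (i + T) - y (i + T)))| ≤
      |x (i - 1 - T) - y (i - 1 - T)| + |x (i + T) - y (i + T)| := by
    rw [abs_mul, ← one_mul (|x (i - 1 - T) - y (i - 1 - T)| + _)]
    exact mul_le_mul hdiff (abs_add_le _ _) (abs_nonneg _) zero_le_one
  rw [hsplit]
  refine (abs_sub _ _).trans (add_le_add ?_ (abs_sub _ _))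
  rw [abs_mul, abs_of_nonneg h0]
  exact mul_le_mul_of_nonneg_left ((abs_add_le _ _).trans (add_le_add hfst hsnd)) h0

/-- Shifting a nonnegative summable sequence to the left does not increase its sum. -/
lemma Summable.tsum_nat_add_le {f : ℕ → ℝ} (hf : Summable f) (hf0 : ∀ i, 0 ≤ f i) (k : ℕ) :
    ∑' i, f (i + k) ≤ ∑' i, f i := by
  rw [← hf.sum_add_tsum_nat_add k]
  exact le_add_of_nonneg_left (Finset.sum_nonneg fun i _ => hf0 i)

/-- Shifting to the right a sequence on `ℤ` that vanishes on negative indices preserves its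
sum over `ℕ`. -/
lemma hasSum_nat_sub_of_eq_zero {f : ℤ → ℝ} {s : ℝ} (hf : HasSum (fun i : ℕ => f i) s)
    (hf0 : ∀ j < 0, f j = 0) (k : ℕ) : HasSum (fun i : ℕ => f (i - k)) s := by
  have hzero : ∑ i ∈ Finset.range k, f ((i : ℤ) - k) = 0 :=
    Finset.sum_eq_zero fun i hi => hf0 _ (by have := Finset.mem_range.1 hi; lia)
  rw [← hasSum_nat_add_iff' k, hzero, sub_zero]
  simpa using hf

/-- Lipschitz continuity of the TTC mean-field drift in the `ℓ¹` norm: for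
nonincreasing `x, y : ℤ → ℝ` with values in `[0,1]`, equal to `1` on nonpositive
indices and with `Σ_{i≥0} |x_i − y_i| < ∞`, the series `Σ_{i≥1} |F_i(x) − F_i(y)|`
converges and is at most `(6λ + 2) Σ_{i≥0} |x_i − y_i|`. -/
theorem ttc_drift_lipschitz (T : ℕ) (hT : 1 ≤ T) (lam : ℝ)
    (h0 : 0 < lam) (h1 : lam < 1)
    (x y : ℤ → ℝ) (hx : Antitone x) (hy : Antitone y)
    (hx01 : ∀ i, 0 ≤ x i ∧ x i ≤ 1) (hy01 : ∀ i, 0 ≤ y i ∧ y i ≤ 1)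
    (hx1 : ∀ j : ℤ, j ≤ 0 → x j = 1) (hy1 : ∀ j : ℤ, j ≤ 0 → y j = 1)
    (hsum : Summable (fun i : ℕ => |x i - y i|)) :
    Summable (fun i : ℕ => |ttcDrift T lam x (i + 1) - ttcDrift T lam y (i + 1)|) ∧
    (∑' i : ℕ, |ttcDrift T lam x (i + 1) - ttcDrift T lam y (i + 1)|) ≤
      (6 * lam + 2) * ∑' i : ℕ, |x i - y i| := by
  set d : ℕ → ℝ := fun i => |x i - y i|
  have hd0 : ∀ i, 0 ≤ d i := fun i => abs_nonneg _
  have hshift (k : ℕ) : Summable fun i => d (i + k) := (summable_nat_add_iff k).2 hsum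
  have hback : HasSum (fun i : ℕ => |x (i - T) - y (i - T)|) (∑' i, d i) :=
    hasSum_nat_sub_of_eq_zero (f := fun j => |x j - y j|) hsum.hasSum
      (fun j hj => by simp [hx1 j hj.le, hy1 j hj.le]) T
  have hbound := ((((hsum.hasSum.add (hshift 1).hasSum).mul_left 2).add
    (hback.add (hshift (T + 1)).hasSum)).mul_left lam).add
    ((hshift 1).hasSum.add (hshift 2).hasSum)
  have hle (i : ℕ) : |ttcDrift T lam x (i + 1) - ttcDrift T lam y (i + 1)| ≤
      lam * (2 * (d i + d (i + 1)) + (|x (i - T) - y (i - T)| + d (i + (T + 1)))) +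
        (d (i + 1) + d (i + 2)) := by
    have h := abs_ttcDrift_sub_le T h0.le hx01 hy01 ((i : ℤ) + 1)
    have hT' : (i : ℤ) + 1 + T = (i + (T + 1) : ℕ) := by push_cast; ring
    have h2 : (i : ℤ) + 1 + 1 = (i + 2 : ℕ) := by push_cast; ring
    have h1' : (i : ℤ) + 1 = (i + 1 : ℕ) := by push_cast; ring
    rwa [add_sub_cancel_right, hT', h2, h1'] at h
  have hs := Summable.of_nonneg_of_le (fun i => abs_nonneg _) hle hbound.summable
  refine ⟨hs, (hasSum_le hle hs.hasSum hbound).trans ?_⟩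
  have hk := hsum.tsum_nat_add_le hd0
  have hlam : lam * (2 * (∑' i, d i + ∑' i, d (i + 1)) + (∑' i, d i + ∑' i, d (i + (T + 1)))) ≤
      lam * (6 * ∑' i, d i) :=
    mul_le_mul_of_nonneg_left (by linarith [hk 1, hk (T + 1)]) h0.le
  linarith [hk 1, hk 2]
end
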